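/- Let k be a positive integer and let ε > 0. Then there exists C = C(k,ε) such that if t = t(n) and b = b(n) satisfy t ≥ C·n and b ≥ (k−ε)·n/2, then there exists a (t,b)-strategy of Builder such that, with probability tending to 1 as n → ∞, the purchased graph B_t has maximum degree at most k and all but at most εn of its vertices have degree exactly k. -/

import Mathlib

open Filter

attribute [local instance] Classical.propDecidable

/-- The edges of the complete graph on `Fin n`: non-diagonal unordered pairs. -/
abbrev CEdge (n : ℕ) : Type := {e : Sym2 (Fin n) // ¬ e.IsDiag}

/-- The sample space: a uniformly random ordering of the edges of `K_n`,
encoded as a bijection from positions to edges. -/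
abbrev EdgeOrdering (n : ℕ) : Type := Fin (Fintype.card (CEdge n)) ≃ CEdge n

/-- The uniform probability of an event on a finite sample space. -/
noncomputable def uprob {α : Type} [Fintype α] (P : α → Prop) : ℝ :=
  ((Finset.univ.filter P).card : ℝ) / (Fintype.card α : ℝ)

/-- A (deterministic) strategy of Builder: given the current time `s`, the graph `B_{s-1}`
of previously purchased edges, and the observed edge `e_s`, decide whether to purchase it. -/
def Strategy (n : ℕ) : Type := ℕ → Finset (CEdge n) → CEdge n → Bool

/-- Builder's purchased graph `B_s` at time `s`, playing strategy `S` with budget `b`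
on the ordering `ω`.  An edge is purchased iff the strategy accepts it and the budget permits. -/
noncomputable def build (n b : ℕ) (S : Strategy n) (ω : EdgeOrdering n) : ℕ → Finset (CEdge n)
  | 0 => ∅
  | s + 1 =>
    let P := build n b S ω s
    if h : s < Fintype.card (CEdge n) then
      if S s P (ω ⟨s, h⟩) = true ∧ P.card < b then insert (ω ⟨s, h⟩) P else P
    else P

/-- The degree of the vertex `v` in the graph given by the edge set `P`. -/
noncomputable def edegree (n : ℕ) (P : Finset (CEdge n)) (v : Fin n) : ℕ :=
  (P.filter (fun e => v ∈ (e : Sym2 (Fin n)))).card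

/-- A uniformly random bijection avoids `A` on all of `J` with probability at most
`(1 - |A| / |β|) ^ |J|`. -/
theorem card_equiv_avoid_le {α β : Type} [Fintype α] [Fintype (α ≃ β)] (A : Finset β) {ρ : ℝ}
    (hρ1 : ρ ≤ 1) (hρ : ρ * Fintype.card α ≤ A.card) (J : Finset α) :
    ((Finset.univ.filter (fun ω : α ≃ β => ∀ i ∈ J, ω i ∉ A)).card : ℝ)
      ≤ (1 - ρ) ^ J.card * Fintype.card (α ≃ β) := by
  induction J using Finset.induction_on with
  | empty => simp
  | insert i₀ J hi₀ ih =>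
    set S := Finset.univ.filter (fun ω : α ≃ β => ∀ i ∈ J, ω i ∉ A) with hS
    have hsymm : ∀ i ∈ Jᶜ, (S.filter (fun ω => ω i ∈ A)).card
        = (S.filter (fun ω => ω i₀ ∈ A)).card := by
      intro i hi
      rw [Finset.mem_compl] at hi
      have hfix : ∀ j ∈ J, Equiv.swap i i₀ j = j := fun j hj =>
        Equiv.swap_apply_of_ne_of_ne (fun h => hi (h ▸ hj)) (fun h => hi₀ (h ▸ hj))
      refine Finset.card_bij' (fun ω _ => (Equiv.swap i i₀).trans ω)
        (fun ω _ => (Equiv.swap i i₀).trans ω) ?_ ?_ ?_ ?_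
      · intro ω hω
        simp only [hS, Finset.mem_filter, Finset.mem_univ, true_and] at hω ⊢
        refine ⟨fun j hj => ?_, ?_⟩
        · simpa [hfix j hj] using hω.1 j hj
        · simpa using hω.2
      · intro ω hω
        simp only [hS, Finset.mem_filter, Finset.mem_univ, true_and] at hω ⊢
        refine ⟨fun j hj => ?_, ?_⟩
        · simpa [hfix j hj] using hω.1 j hj
        · simpa using hω.2
      · intro ω _; ext; simp
      · intro ω _; ext; simp
    have hcount : ∑ i ∈ Jᶜ, (S.filter (fun ω => ω i ∈ A)).card = S.card * A.card := by
      have h := Finset.sum_card_bipartiteAbove_eq_sum_card_bipartiteBelow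
        (s := Jᶜ) (t := S) (fun i (ω : α ≃ β) => ω i ∈ A)
      simp only [Finset.bipartiteAbove, Finset.bipartiteBelow] at h
      rw [h, Finset.sum_const_nat]
      intro ω hω
      simp only [hS, Finset.mem_filter, Finset.mem_univ, true_and] at hω
      refine Finset.card_bij (fun i _ => ω i) ?_ ?_ ?_
      · intro i hi; exact (Finset.mem_filter.1 hi).2
      · intro i _ j _ h; exact ω.injective h
      · intro b hb
        refine ⟨ω.symm b, ?_, by simp⟩
        simp only [Finset.mem_filter, Finset.mem_compl, Equiv.apply_symm_apply]
        exact ⟨fun h => hω _ h (by simpa using hb), hb⟩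
    rw [Finset.sum_congr rfl hsymm, Finset.sum_const, smul_eq_mul] at hcount
    have hsplit := Finset.card_filter_add_card_filter_not (s := S) (fun ω => ω i₀ ∈ A)
    have heq : Finset.univ.filter (fun ω : α ≃ β => ∀ i ∈ insert i₀ J, ω i ∉ A)
        = S.filter (fun ω => ¬ ω i₀ ∈ A) := by
      ext ω
      simp only [hS, Finset.mem_filter, Finset.mem_univ, true_and, Finset.mem_insert,
        forall_eq_or_imp]
      tauto
    rw [heq, Finset.card_insert_of_notMem hi₀, pow_succ]
    set a := (S.filter (fun ω => ω i₀ ∈ A)).card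
    have hpos : (0 : ℝ) < Fintype.card α := by
      exact_mod_cast Fintype.card_pos_iff.2 ⟨i₀⟩
    have h1 : (S.card : ℝ) * A.card ≤ Fintype.card α * a := by
      rw [← Nat.cast_mul, ← hcount, ← Nat.cast_mul]
      exact_mod_cast Nat.mul_le_mul_right _ (Finset.card_le_univ _)
    have h2 : ρ * S.card ≤ a := by
      have := mul_le_mul_of_nonneg_left hρ (Nat.cast_nonneg (α := ℝ) S.card)
      refine le_of_mul_le_mul_left ?_ hpos
      nlinarith
    have h3 : ((S.filter (fun ω => ¬ ω i₀ ∈ A)).card : ℝ) = S.card - a := by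
      rw [← hsplit]; push_cast; ring
    rw [h3]
    nlinarith [mul_le_mul_of_nonneg_left ih (sub_nonneg.2 hρ1)]

/-- Lower tail bound for the number of positions of `I` that a uniformly random bijection
sends into `A`. -/
theorem card_equiv_few_hits_le {α β : Type} [Fintype α] [Fintype (α ≃ β)] (A : Finset β) {ρ : ℝ}
    (hρ0 : 0 < ρ) (hρ1 : ρ ≤ 1) (hρ : ρ * Fintype.card α ≤ A.card) (I : Finset α) (K : ℕ) :
    ((Finset.univ.filter
        (fun ω : α ≃ β => (I.filter (fun i => ω i ∈ A)).card ≤ K)).card : ℝ)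
      ≤ ((ρ / 2) ^ K)⁻¹ * (1 - ρ / 2) ^ I.card * Fintype.card (α ≃ β) := by
  have hsub : Finset.univ.filter
        (fun ω : α ≃ β => (I.filter (fun i => ω i ∈ A)).card ≤ K)
      ⊆ (I.powerset.filter (fun H => H.card ≤ K)).biUnion
        (fun H => Finset.univ.filter (fun ω : α ≃ β => ∀ i ∈ I \ H, ω i ∉ A)) := by
    intro ω hω
    simp only [Finset.mem_filter, Finset.mem_univ, true_and] at hω
    simp only [Finset.mem_biUnion, Finset.mem_filter, Finset.mem_univ, true_and,
      Finset.mem_powerset]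
    refine ⟨_, ⟨Finset.filter_subset _ I, hω⟩, fun i hi hA => ?_⟩
    rw [Finset.mem_sdiff, Finset.mem_filter] at hi
    exact hi.2 ⟨hi.1, hA⟩
  have hy : (0 : ℝ) < ρ / 2 := by positivity
  calc _ ≤ ((∑ H ∈ I.powerset.filter (fun H => H.card ≤ K), (Finset.univ.filter
            (fun ω : α ≃ β => ∀ i ∈ I \ H, ω i ∉ A)).card : ℕ) : ℝ) := by
          exact_mod_cast (Finset.card_le_card hsub).trans Finset.card_biUnion_le
    _ ≤ ∑ H ∈ I.powerset.filter (fun H => H.card ≤ K), ((ρ / 2) ^ K)⁻¹ *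
          ((ρ / 2) ^ H.card * (1 - ρ) ^ (I.card - H.card)) * Fintype.card (α ≃ β) := by
          push_cast
          refine Finset.sum_le_sum fun H hH => ?_
          rw [Finset.mem_filter, Finset.mem_powerset] at hH
          have h1 := card_equiv_avoid_le A hρ1 hρ (I \ H)
          rw [Finset.card_sdiff_of_subset hH.1] at h1
          refine h1.trans (mul_le_mul_of_nonneg_right ?_ (Nat.cast_nonneg _))
          rw [← mul_assoc]
          refine le_mul_of_one_le_left (pow_nonneg (by linarith) _) ?_
          rw [inv_mul_eq_div, one_le_div (by positivity)]
          exact pow_le_pow_of_le_one hy.le (by linarith) hH.2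
    _ ≤ ∑ H ∈ I.powerset, ((ρ / 2) ^ K)⁻¹ *
          ((ρ / 2) ^ H.card * (1 - ρ) ^ (I.card - H.card)) * Fintype.card (α ≃ β) := by
          refine Finset.sum_le_sum_of_subset_of_nonneg (Finset.filter_subset _ _) ?_
          intro H _ _
          have : 0 ≤ 1 - ρ := by linarith
          positivity
    _ = _ := by
          rw [← Finset.sum_mul, ← Finset.mul_sum, Finset.sum_pow_mul_eq_add_pow]
          congr 3
          ring

/-- The edges of the complete graph with both endpoints in `U`. -/
noncomputable def edgesWithin {n : ℕ} (U : Finset (Fin n)) : Finset (CEdge n) :=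
  Finset.univ.filter (fun e : CEdge n => ∀ v ∈ (e : Sym2 (Fin n)), v ∈ U)

theorem card_edgesWithin {n : ℕ} (U : Finset (Fin n)) :
    (edgesWithin U).card = U.card.choose 2 := by
  rw [← Sym2.card_image_offDiag]
  refine Finset.card_bij (fun (e : CEdge n) _ => (e : Sym2 (Fin n))) ?_ ?_ ?_
  · rintro ⟨e, he⟩ h
    induction e using Sym2.ind with
    | _ x y =>
      simp only [edgesWithin, Finset.mem_filter, Finset.mem_univ, true_and, Sym2.mem_iff,
        forall_eq_or_imp, forall_eq] at h
      rw [Finset.mem_image]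
      exact ⟨(x, y), by simpa [Finset.mem_offDiag, h] using he, rfl⟩
  · intro e _ f _ h; exact Subtype.ext h
  · intro e he
    rw [Finset.mem_image] at he
    obtain ⟨⟨x, y⟩, hxy, rfl⟩ := he
    rw [Finset.mem_offDiag] at hxy
    refine ⟨⟨s(x, y), by simpa using hxy.2.2⟩, ?_, rfl⟩
    simp [edgesWithin, hxy.1, hxy.2.1]

theorem edegree_eq {n : ℕ} (P : Finset (CEdge n)) (v : Fin n) :
    edegree n P v = (P.filter (fun e : CEdge n => v ∈ (e : Sym2 (Fin n)))).card := by
  refine (Finset.card_bij (fun (e : CEdge n) _ => (e : Sym2 (Fin n))) ?_ ?_ ?_).symm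
  · intro e he
    simp only [Finset.mem_filter] at he
    simpa [Finset.bind_def, he.2] using ⟨e.2, he.1⟩
  · intro e _ f _ h; exact Subtype.ext h
  · intro e he
    simpa [Finset.bind_def, and_comm] using he

theorem sum_edegree {n : ℕ} (P : Finset (CEdge n)) : ∑ v, edegree n P v = 2 * P.card := by
  have h := Finset.sum_card_bipartiteAbove_eq_sum_card_bipartiteBelow
    (s := (Finset.univ : Finset (Fin n))) (t := P) (fun v (e : CEdge n) => v ∈ (e : Sym2 (Fin n)))
  simp only [Finset.bipartiteAbove, Finset.bipartiteBelow] at h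
  simp only [edegree_eq]
  rw [h, mul_comm, Finset.sum_const_nat]
  rintro ⟨e, he⟩ -
  rw [← Sym2.card_toFinset_of_not_isDiag e he]
  congr 1
  ext v
  simp

theorem edegree_mono {n : ℕ} {P Q : Finset (CEdge n)} (h : P ⊆ Q) (v : Fin n) :
    edegree n P v ≤ edegree n Q v := by
  rw [edegree_eq, edegree_eq]
  exact Finset.card_le_card (Finset.filter_subset_filter _ h)

theorem edegree_insert_le {n : ℕ} (P : Finset (CEdge n)) (e : CEdge n) (v : Fin n) :
    edegree n (insert e P) v
      ≤ edegree n P v + if v ∈ (e : Sym2 (Fin n)) then 1 else 0 := by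
  rw [edegree_eq, edegree_eq, Finset.filter_insert]
  split_ifs
  · exact Finset.card_insert_le _ _
  · simp

/-- The greedy strategy: buy an edge iff both of its endpoints have degree less than `k`. -/
noncomputable def greedyStrategy (k n : ℕ) : Strategy n :=
  fun _ P e => decide (∀ v ∈ (e : Sym2 (Fin n)), edegree n P v < k)

section Build

variable {n b k : ℕ} {S : Strategy n} {ω : EdgeOrdering n}

theorem build_mono : Monotone (build n b S ω) := by
  refine monotone_nat_of_le_succ fun s => ?_
  simp only [build]
  split_ifs
  · exact Finset.subset_insert _ _
  · exact le_rfl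
  · exact le_rfl

theorem card_build_le (s : ℕ) : (build n b S ω s).card ≤ b := by
  induction s with
  | zero => simp [build]
  | succ s ih =>
    simp only [build]
    split_ifs with h1 h2
    · exact (Finset.card_insert_le _ _).trans h2.2
    · exact ih
    · exact ih

theorem edegree_build_greedy_le (s : ℕ) (v : Fin n) :
    edegree n (build n b (greedyStrategy k n) ω s) v ≤ k := by
  induction s with
  | zero => simp [build, edegree]
  | succ s ih =>
    simp only [build]
    split_ifs with h1 h2
    · refine (edegree_insert_le _ _ _).trans ?_
      split_ifs with hv
      · exact (of_decide_eq_true h2.1 : ∀ v ∈ _, _ < k) v hv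
      · exact ih
    · exact ih
    · exact ih

theorem mem_build_greedy {t s : ℕ} (hst : s < t) (hs : s < Fintype.card (CEdge n))
    (hb : (build n b (greedyStrategy k n) ω t).card < b)
    (hω : ∀ v ∈ (ω ⟨s, hs⟩ : Sym2 (Fin n)),
      edegree n (build n b (greedyStrategy k n) ω t) v < k) :
    ω ⟨s, hs⟩ ∈ build n b (greedyStrategy k n) ω t := by
  have hsub := build_mono (b := b) (S := greedyStrategy k n) (ω := ω) hst.le
  refine build_mono (Nat.succ_le_of_lt hst) ?_
  simp only [build]
  rw [dif_pos hs, if_pos]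
  · exact Finset.mem_insert_self _ _
  · exact ⟨decide_eq_true fun v hv => (edegree_mono hsub v).trans_lt (hω v hv),
      (Finset.card_le_card hsub).trans_lt hb⟩

/-- If every vertex set of size more than `ε n` receives more than `k n` of the first `T` edges,
then the greedy strategy saturates all but at most `ε n` vertices. -/
theorem card_unsaturated_le {ε : ℝ} {t T : ℕ} (hTt : T ≤ t)
    (hb : ((k : ℝ) - ε) * n / 2 ≤ b)
    (hω : ∀ U : Finset (Fin n), ε * n < U.card →
      k * n < ((Finset.univ.filter
        (fun i : Fin (Fintype.card (CEdge n)) => i.val < T)).filter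
          (fun i => ω i ∈ edgesWithin U)).card) :
    ((Finset.univ.filter
      (fun v : Fin n => edegree n (build n b (greedyStrategy k n) ω t) v ≠ k)).card : ℝ)
      ≤ ε * n := by
  set P := build n b (greedyStrategy k n) ω t with hP
  set U := Finset.univ.filter (fun v : Fin n => edegree n P v ≠ k) with hU
  have hdeg : ∀ v, edegree n P v ≤ k := edegree_build_greedy_le t
  have hsum := sum_edegree P
  rcases (card_build_le t : P.card ≤ b).lt_or_eq with hlt | heq
  · by_contra! hbig
    have h1 : 2 * P.card ≤ k * n := by
      rw [← hsum]
      refine (Finset.sum_le_sum fun v _ => hdeg v).trans ?_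
      simp [mul_comm]
    have h2 := hω U hbig
    have h3 : ((Finset.univ.filter
        (fun i : Fin (Fintype.card (CEdge n)) => i.val < T)).filter
          (fun i => ω i ∈ edgesWithin U)).card ≤ P.card := by
      refine Finset.card_le_card_of_injOn ω ?_ ω.injective.injOn
      intro i hi
      simp only [Finset.coe_filter, Finset.mem_filter, Finset.mem_univ, true_and,
        Set.mem_ofPred_eq, edgesWithin, hU] at hi
      exact mem_build_greedy (hi.1.trans_le hTt) i.2 hlt
        fun v hv => lt_of_le_of_ne (hdeg v) (hi.2 v hv)
    omega
  · have h1 : U.card + ∑ v, edegree n P v ≤ k * n := by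
      rw [hU, Finset.card_filter, ← Finset.sum_add_distrib]
      refine (Finset.sum_le_card_nsmul _ _ k fun v _ => ?_).trans (by simp [mul_comm])
      have := hdeg v
      split_ifs <;> omega
    rw [hsum, heq] at h1
    have h2 : (U.card : ℝ) + 2 * b ≤ k * n := by exact_mod_cast h1
    linarith

end Build

/-- Union bound: all large vertex sets receive many of the first `D n` edges, except with
exponentially small probability. -/
theorem card_exists_sparse_le {ε : ℝ} (hε : 0 < ε) (hε1 : ε ≤ 1) {n k D : ℕ}
    (hn : 2 ≤ ε * n) (hDn : 2 * D + 1 ≤ n) :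
    ((Finset.univ.filter (fun ω : EdgeOrdering n => ∃ U : Finset (Fin n), ε * n < U.card ∧
      ((Finset.univ.filter
        (fun i : Fin (Fintype.card (CEdge n)) => i.val < D * n)).filter
          (fun i => ω i ∈ edgesWithin U)).card ≤ k * n)).card : ℝ)
      ≤ (2 * ((ε ^ 2 / 4) ^ k)⁻¹ * (1 - ε ^ 2 / 4) ^ D) ^ n
        * Fintype.card (EdgeOrdering n) := by
  set I := Finset.univ.filter (fun i : Fin (Fintype.card (CEdge n)) => i.val < D * n) with hI
  have hN : Fintype.card (CEdge n) = n.choose 2 := by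
    rw [Sym2.card_subtype_not_diag, Fintype.card_fin]
  have hIcard : I.card = D * n := by
    rw [hI, Fin.card_filter_val_lt, min_eq_right]
    rw [hN, Nat.choose_two_right, Nat.le_div_iff_mul_le two_pos]
    calc D * n * 2 = n * (2 * D) := by ring
      _ ≤ n * (n - 1) := Nat.mul_le_mul_left _ (by omega)
  have hsub : Finset.univ.filter (fun ω : EdgeOrdering n => ∃ U : Finset (Fin n),
        ε * n < U.card ∧ (I.filter (fun i => ω i ∈ edgesWithin U)).card ≤ k * n)
      ⊆ (Finset.univ.filter (fun U : Finset (Fin n) => ε * n < U.card)).biUnion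
        (fun U => Finset.univ.filter (fun ω : EdgeOrdering n =>
          (I.filter (fun i => ω i ∈ edgesWithin U)).card ≤ k * n)) := by
    intro ω hω
    simpa using hω
  calc _ ≤ ((∑ U ∈ Finset.univ.filter (fun U : Finset (Fin n) => ε * n < U.card),
            (Finset.univ.filter (fun ω : EdgeOrdering n =>
              (I.filter (fun i => ω i ∈ edgesWithin U)).card ≤ k * n)).card : ℕ) : ℝ) := by
          exact_mod_cast (Finset.card_le_card hsub).trans Finset.card_biUnion_le
    _ ≤ ∑ U ∈ Finset.univ.filter (fun U : Finset (Fin n) => ε * n < U.card),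
          ((ε ^ 2 / 2 / 2) ^ (k * n))⁻¹ * (1 - ε ^ 2 / 2 / 2) ^ I.card
            * Fintype.card (EdgeOrdering n) := by
          push_cast
          refine Finset.sum_le_sum fun U hU => ?_
          rw [Finset.mem_filter] at hU
          have hρ : ε ^ 2 / 2 * (Fintype.card (Fin (Fintype.card (CEdge n))) : ℝ)
              ≤ (edgesWithin U).card := ?_
          · refine le_of_eq_of_le ?_
              (card_equiv_few_hits_le _ (by positivity) (by nlinarith) hρ I (k * n))
            congr!
          rw [Fintype.card_fin, hN, card_edgesWithin, Nat.cast_choose_two, Nat.cast_choose_two]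
          nlinarith [mul_le_mul hU.2.le (sub_le_sub_right hU.2.le 1) (by linarith)
            (Nat.cast_nonneg _), mul_nonneg (by linarith : 0 ≤ ε * n) (sub_nonneg.2 hn)]
    _ ≤ ∑ _U : Finset (Fin n),
          ((ε ^ 2 / 2 / 2) ^ (k * n))⁻¹ * (1 - ε ^ 2 / 2 / 2) ^ I.card
            * Fintype.card (EdgeOrdering n) := by
          refine Finset.sum_le_sum_of_subset_of_nonneg (Finset.filter_subset _ _) ?_
          intro _ _ _
          have : 0 ≤ 1 - ε ^ 2 / 2 / 2 := by nlinarith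
          positivity
    _ = _ := by
          rw [Finset.sum_const, Finset.card_univ, Fintype.card_finset, Fintype.card_fin, hIcard,
            nsmul_eq_mul, pow_mul, pow_mul, mul_pow, mul_pow, inv_pow]
          push_cast
          ring

theorem uprob_le_one {α : Type} [Fintype α] (P : α → Prop) : uprob P ≤ 1 :=
  div_le_one_of_le₀ (by exact_mod_cast Finset.card_le_univ _) (Nat.cast_nonneg _)

theorem one_sub_le_uprob {α : Type} [Fintype α] [Nonempty α] {P Q : α → Prop} [DecidablePred Q] {δ : ℝ}
    (hQ : ((Finset.univ.filter Q).card : ℝ) ≤ δ * Fintype.card α) (h : ∀ a, ¬ Q a → P a) :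
    1 - δ ≤ uprob P := by
  have hpos : (0 : ℝ) < Fintype.card α := by exact_mod_cast Fintype.card_pos
  rw [uprob, le_div_iff₀ hpos]
  have h1 : Fintype.card α
      ≤ (Finset.univ.filter Q).card + (Finset.univ.filter P).card := by
    rw [← Finset.card_univ, ← Finset.card_filter_add_card_filter_not (s := Finset.univ) Q]
    refine Nat.add_le_add_left (Finset.card_le_card ?_) _
    exact Finset.monotone_filter_right _ fun a _ => h a
  have h2 : (Fintype.card α : ℝ)
      ≤ (Finset.univ.filter Q).card + (Finset.univ.filter P).card := by exact_mod_cast h1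
  linarith

/-- Greedy `k`-matchings: for every `k` and `ε > 0` there is `C` such that if `t ≥ C n` and
`b ≥ (k-ε) n / 2`, Builder has a `(t,b)`-strategy whose purchased graph has, with high
probability, maximum degree at most `k` with all but at most `εn` vertices of degree
exactly `k`. -/
theorem stmt12 (k : ℕ) (hk : 0 < k) (ε : ℝ) (hε : 0 < ε) :
    ∃ C : ℝ, 0 < C ∧
      ∀ t b : ℕ → ℕ,
        (∀ n : ℕ, C * n ≤ (t n : ℝ)) →
        (∀ n : ℕ, ((k : ℝ) - ε) * n / 2 ≤ (b n : ℝ)) →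
        ∃ S : (n : ℕ) → Strategy n,
          Tendsto
            (fun n => uprob (fun ω : EdgeOrdering n =>
              (∀ v : Fin n, edegree n (build n (b n) (S n) ω (t n)) v ≤ k) ∧
              (((Finset.univ.filter
                  (fun v : Fin n => edegree n (build n (b n) (S n) ω (t n)) v ≠ k)).card : ℝ)
                ≤ ε * n)))
            atTop (nhds 1) := by
  set η := min ε 1 with hη
  have hη0 : 0 < η := lt_min hε one_pos
  have hη1 : η ≤ 1 := min_le_right _ _
  have hq0 : 0 ≤ 1 - η ^ 2 / 4 := by nlinarith
  have hq1 : 1 - η ^ 2 / 4 < 1 := by nlinarith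
  obtain ⟨D, hD⟩ : ∃ D : ℕ, 2 * ((η ^ 2 / 4) ^ k)⁻¹ * (1 - η ^ 2 / 4) ^ D < 1 / 2 := by
    have h := (tendsto_pow_atTop_nhds_zero_of_lt_one hq0 hq1).const_mul
      (2 * ((η ^ 2 / 4) ^ k)⁻¹)
    rw [mul_zero] at h
    exact (h.eventually (gt_mem_nhds (by norm_num : (0 : ℝ) < 1 / 2))).exists
  refine ⟨D + 1, by positivity, fun t b ht hb => ⟨greedyStrategy k, ?_⟩⟩
  have hlim : Tendsto (fun n : ℕ => 1 - (1 / 2 : ℝ) ^ n) atTop (nhds 1) := by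
    simpa using (tendsto_pow_atTop_nhds_zero_of_lt_one (by norm_num : (0 : ℝ) ≤ 1 / 2)
      (by norm_num)).const_sub 1
  refine tendsto_of_tendsto_of_tendsto_of_le_of_le' hlim tendsto_const_nhds ?_
    (Eventually.of_forall fun n => uprob_le_one _)
  filter_upwards [eventually_ge_atTop (2 * D + 1), eventually_ge_atTop ⌈2 / η⌉₊]
    with n hn1 hn2
  have hn3 : 2 ≤ η * n := by
    rw [mul_comm, ← div_le_iff₀ hη0]
    exact Nat.ceil_le.1 hn2
  have hTt : D * n ≤ t n := by
    have h := ht n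
    have h' : (D : ℝ) * n ≤ t n := by nlinarith [Nat.cast_nonneg (α := ℝ) n]
    exact_mod_cast h'
  have : Nonempty (EdgeOrdering n) := ⟨(Fintype.equivFin _).symm⟩
  refine one_sub_le_uprob ((card_exists_sparse_le hη0 hη1 (k := k) hn3 hn1).trans ?_) ?_
  · gcongr
  · intro ω hω
    refine ⟨edegree_build_greedy_le _, card_unsaturated_le hTt (hb n) fun U hU => ?_⟩
    by_contra! hle
    refine hω ⟨U, lt_of_le_of_lt ?_ hU, hle⟩
    gcongr
    exact min_le_left _ _
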